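/- Let G be 3-edge-connected with DFS tree T rooted at r. Let u be a descendant of a vertex v ≠ r such that m = M(v) satisfies m ∈ {M(u), M̃(u), M_low1(u)}. Then u ∈ U(v) if and only if v is the maximum vertex in M⁻¹(m) less than u and b_count(u) = b_count(v) + 1. -/

import Mathlib

/-- An undirected multigraph `G` (parallel edges allowed, no self-loops) together with a
DFS spanning tree `T` rooted at `root`, where the vertices are identified with their DFS
preorder numbers (so they are `Fin n`, and the root gets the smallest number).
Tree edges are oriented from child to parent and back-edges from descendant to
(proper) ancestor. -/
structure DFSGraph where
  /-- number of vertices; the vertices are `Fin n`, numbered in DFS preorder -/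
  n : ℕ
  /-- the type indexing the edges (parallel edges are allowed) -/
  Edge : Type
  edgeFintype : Fintype Edge
  /-- the first endpoint (the descendant end) of each edge -/
  fst : Edge → Fin n
  /-- the second endpoint (the ancestor end) of each edge -/
  snd : Edge → Fin n
  /-- no self-loops -/
  noloop : ∀ e, fst e ≠ snd e
  /-- the root `r` of the DFS tree -/
  root : Fin n
  /-- in DFS preorder the root gets the smallest number -/
  root_le : ∀ v, root ≤ v
  /-- the parent function `p` of the DFS tree (arbitrary at the root) -/
  parent : Fin n → Fin n
  /-- the parent of a non-root vertex precedes it in preorder -/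
  parent_lt : ∀ v, v ≠ root → parent v < v
  /-- `tEdge v` is the tree edge `(v, p(v))`, for `v ≠ root` -/
  tEdge : Fin n → Edge
  tEdge_fst : ∀ v, v ≠ root → fst (tEdge v) = v
  tEdge_snd : ∀ v, v ≠ root → snd (tEdge v) = parent v
  tEdge_inj : ∀ u v, u ≠ root → v ≠ root → tEdge u = tEdge v → u = v
  /-- DFS property: every non-tree edge is a back-edge, i.e. it joins a vertex to an
  ancestor of it (a proper ancestor, by `noloop`) -/
  back_anc : ∀ e, (¬ ∃ v, v ≠ root ∧ e = tEdge v) →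
    Relation.ReflTransGen (fun x y => x ≠ root ∧ y = parent x) (fst e) (snd e)
  /-- preorder property: the descendants of any vertex form an interval of preorder
  numbers starting at that vertex -/
  preorder_interval : ∀ v u w : Fin n, v ≤ u → u ≤ w →
    Relation.ReflTransGen (fun x y => x ≠ root ∧ y = parent x) w v →
    Relation.ReflTransGen (fun x y => x ≠ root ∧ y = parent x) u v

namespace DFSGraph

variable (G : DFSGraph)

/-- `Anc a b`: `a` is an ancestor of `b` in `T` (every vertex is an ancestor of itself). -/
def Anc (a b : Fin G.n) : Prop :=
  Relation.ReflTransGen (fun x y => x ≠ G.root ∧ y = G.parent x) b a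

/-- `PAnc a b`: `a` is a proper ancestor of `b` in `T`. -/
def PAnc (a b : Fin G.n) : Prop := G.Anc a b ∧ a ≠ b

/-- `e` is an edge of the spanning tree `T`. -/
def IsTreeEdge (e : G.Edge) : Prop := ∃ v, v ≠ G.root ∧ e = G.tEdge v

/-- `e` is a back-edge (an edge of `G ∖ T`). -/
def IsBack (e : G.Edge) : Prop := ¬ G.IsTreeEdge e

/-- `B v`: the set of back-edges `(x, y)` with `x` a descendant of `v` and `y` a proper
ancestor of `v`. -/
def B (v : Fin G.n) : Set G.Edge :=
  {e | G.IsBack e ∧ G.Anc v (G.fst e) ∧ G.PAnc (G.snd e) v}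

/-- `b_count(v) = |B(v)|`. -/
noncomputable def bcount (v : Fin G.n) : ℕ := (G.B v).ncard

/-- adjacency in `G` after removing the edge set `S` -/
def AdjOff (S : Set G.Edge) (x y : Fin G.n) : Prop :=
  ∃ e, e ∉ S ∧ ((G.fst e = x ∧ G.snd e = y) ∨ (G.fst e = y ∧ G.snd e = x))

/-- `G ∖ S` is connected -/
def ConnectedOff (S : Set G.Edge) : Prop :=
  ∀ x y, Relation.ReflTransGen (G.AdjOff S) x y

/-- `S` is an edge cut of `G`: removing `S` disconnects `G`. -/
def IsCut (S : Set G.Edge) : Prop := ¬ G.ConnectedOff S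

/-- `G` is `k`-edge-connected: it has no cut of fewer than `k` edges. -/
def EdgeConn (k : ℕ) : Prop := ∀ S : Set G.Edge, S.ncard < k → ¬ G.IsCut S

/-- `IsLow1 v y`: `y = low1(v) = min {y | ∃ (x,y) ∈ B(v)}`. -/
def IsLow1 (v y : Fin G.n) : Prop :=
  (∃ e ∈ G.B v, G.snd e = y) ∧ ∀ e ∈ G.B v, y ≤ G.snd e

/-- `IsHigh v y`: `y = high(v) = max {y | ∃ (x,y) ∈ B(v)}`. -/
def IsHigh (v y : Fin G.n) : Prop :=
  (∃ e ∈ G.B v, G.snd e = y) ∧ ∀ e ∈ G.B v, G.snd e ≤ y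

/-- `IsLow2 v y`: `y = low2(v)`, the minimum lower end of the back-edges in `B(v)` minus
one (fixed, but arbitrary) back-edge `(low1D(v), low1(v))` attaining `low1(v)`. -/
def IsLow2 (v y : Fin G.n) : Prop :=
  ∃ f ∈ G.B v, (∀ g ∈ G.B v, G.snd f ≤ G.snd g) ∧
    (∃ e ∈ G.B v, e ≠ f ∧ G.snd e = y) ∧
    (∀ e ∈ G.B v, e ≠ f → y ≤ G.snd e)

/-- `IsL1 v y`: `y = l1(v) = min ({y | (v,y) is a back-edge} ∪ {v})`. -/
def IsL1 (v y : Fin G.n) : Prop :=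
  (y = v ∨ ∃ e, G.IsBack e ∧ G.fst e = v ∧ G.snd e = y) ∧
  y ≤ v ∧ (∀ e, G.IsBack e → G.fst e = v → y ≤ G.snd e)

/-- `IsL2 v y`: `y = l2(v)`, defined as `l1(v)` but after removing one (fixed, but
arbitrary) back-edge `(v, l1(v))` attaining `l1(v)`, if such a back-edge exists. -/
def IsL2 (v y : Fin G.n) : Prop :=
  ((¬ ∃ e, G.IsBack e ∧ G.fst e = v) ∧ y = v) ∨
  (∃ f, G.IsBack f ∧ G.fst f = v ∧
    (∀ g, G.IsBack g → G.fst g = v → G.snd f ≤ G.snd g) ∧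
    (y = v ∨ ∃ e, G.IsBack e ∧ G.fst e = v ∧ e ≠ f ∧ G.snd e = y) ∧
    y ≤ v ∧
    (∀ e, G.IsBack e → G.fst e = v → e ≠ f → y ≤ G.snd e))

/-- `z` is the nearest common ancestor of the set of vertices `S`. -/
def IsNCA (S : Set (Fin G.n)) (z : Fin G.n) : Prop :=
  (∀ x ∈ S, G.Anc z x) ∧ ∀ z', (∀ x ∈ S, G.Anc z' x) → G.Anc z' z

/-- `IsM v m`: `m = M(v)`, the nearest common ancestor of all higher ends of back-edges
in `B(v)`. -/
def IsM (v m : Fin G.n) : Prop :=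
  G.IsNCA {x | ∃ e ∈ G.B v, G.fst e = x} m

/-- `IsMtilde v m`: `m = M̃(v)`, the nearest common ancestor of all higher ends of
back-edges in `B(v)` that are proper descendants of `M(v)` (defined only if such a
higher end exists). -/
def IsMtilde (v m : Fin G.n) : Prop :=
  ∃ mv, G.IsM v mv ∧
    {x | ∃ e ∈ G.B v, G.fst e = x ∧ G.PAnc mv x}.Nonempty ∧
    G.IsNCA {x | ∃ e ∈ G.B v, G.fst e = x ∧ G.PAnc mv x} m

/-- `c` is a child of `p` in `T`. -/
def IsChild (p c : Fin G.n) : Prop := c ≠ G.root ∧ G.parent c = p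

/-- `low1(c) ≤ low1(c')` (stated relationally). -/
def Low1LE (c c' : Fin G.n) : Prop :=
  ∀ y y', G.IsLow1 c y → G.IsLow1 c' y' → y ≤ y'

/-- `c = c₁(p)`: `c` is a `low1` child of `p`, i.e. a child of `p` minimizing `low1`. -/
def IsC1 (p c : Fin G.n) : Prop :=
  G.IsChild p c ∧ ∀ c', G.IsChild p c' → G.Low1LE c c'

/-- `c = c₂(p)`: `c` is a `low2` child of `p`, i.e. a child of `p` minimizing `low1`
among the children different from the (fixed) `low1` child. -/
def IsC2 (p c : Fin G.n) : Prop :=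
  ∃ c1, G.IsC1 p c1 ∧ G.IsChild p c ∧ c ≠ c1 ∧
    ∀ c', G.IsChild p c' → c' ≠ c1 → G.Low1LE c c'

/-- `c = c₃(p)`: `c` is a `low3` child of `p`. -/
def IsC3 (p c : Fin G.n) : Prop :=
  ∃ c1 c2, G.IsC1 p c1 ∧
    (G.IsChild p c2 ∧ c2 ≠ c1 ∧ ∀ c', G.IsChild p c' → c' ≠ c1 → G.Low1LE c2 c') ∧
    G.IsChild p c ∧ c ≠ c1 ∧ c ≠ c2 ∧
    (∀ c', G.IsChild p c' → c' ≠ c1 → c' ≠ c2 → G.Low1LE c c')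

/-- `IsMlow1 v m`: `m = M_low1(v)`, the nearest common ancestor of all higher ends of
back-edges in `B(v)` that are descendants of the `low1` child of `M(v)` (defined only
if such a higher end exists). -/
def IsMlow1 (v m : Fin G.n) : Prop :=
  ∃ mv c1, G.IsM v mv ∧ G.IsC1 mv c1 ∧
    {x | ∃ e ∈ G.B v, G.fst e = x ∧ G.Anc c1 x}.Nonempty ∧
    G.IsNCA {x | ∃ e ∈ G.B v, G.fst e = x ∧ G.Anc c1 x} m

/-- `IsMlow2 v m`: `m = M_low2(v)`, the nearest common ancestor of all higher ends of
back-edges in `B(v)` that are descendants of the `low2` child of `M(v)` (defined only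
if such a higher end exists). -/
def IsMlow2 (v m : Fin G.n) : Prop :=
  ∃ mv c2, G.IsM v mv ∧ G.IsC2 mv c2 ∧
    {x | ∃ e ∈ G.B v, G.fst e = x ∧ G.Anc c2 x}.Nonempty ∧
    G.IsNCA {x | ∃ e ∈ G.B v, G.fst e = x ∧ G.Anc c2 x} m

/-- `IsNextM v w`: `w = nextM(v)`, the maximum vertex `w < v` with `M(w) = M(v)`. -/
def IsNextM (v w : Fin G.n) : Prop :=
  ∃ m, G.IsM v m ∧ G.IsM w m ∧ w < v ∧ ∀ w', w' < v → G.IsM w' m → w' ≤ w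

/-- `IsLowM v l`: `l = low_M(v) = min {y | ∃ (x,y) ∈ B(v) ∖ B(nextM(v))}`. -/
def IsLowM (v l : Fin G.n) : Prop :=
  ∃ w, G.IsNextM v w ∧ (∃ e ∈ G.B v, e ∉ G.B w ∧ G.snd e = l) ∧
    ∀ e ∈ G.B v, e ∉ G.B w → l ≤ G.snd e

end DFSGraph

namespace DFSGraph

variable {G : DFSGraph}

theorem Anc.trans {a b c : Fin G.n} (hab : G.Anc a b) (hbc : G.Anc b c) : G.Anc a c :=
  Relation.ReflTransGen.trans hbc hab

theorem Anc.le {a b : Fin G.n} (h : G.Anc a b) : a ≤ b := by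
  induction h with
  | refl => exact le_rfl
  | tail _ h ih => exact h.2 ▸ (G.parent_lt _ h.1).le.trans ih

theorem Anc.antisymm {a b : Fin G.n} (hab : G.Anc a b) (hba : G.Anc b a) : a = b :=
  le_antisymm hab.le hba.le

/-- Two ancestors of the same vertex are comparable. -/
theorem Anc.total {a b c : Fin G.n} (ha : G.Anc a c) (hb : G.Anc b c) :
    G.Anc a b ∨ G.Anc b a :=
  (Relation.ReflTransGen.total_of_right_unique
    (fun _ _ _ h h' => h.2.trans h'.2.symm) ha hb).symm

theorem Anc.of_le {a b c : Fin G.n} (ha : G.Anc a c) (hb : G.Anc b c) (h : a ≤ b) :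
    G.Anc a b :=
  (ha.total hb).elim id fun hba => le_antisymm h hba.le ▸ Relation.ReflTransGen.refl

theorem PAnc.trans_anc {a b c : Fin G.n} (hab : G.PAnc a b) (hbc : G.Anc b c) : G.PAnc a c :=
  ⟨hab.1.trans hbc, fun h => hab.2 (hab.1.antisymm (h ▸ hbc))⟩

theorem anc_parent_iff {x w : Fin G.n} (hw : w ≠ G.root) (hx : w ≠ x) :
    G.Anc x (G.parent w) ↔ G.Anc x w := by
  constructor
  · exact fun h => h.head ⟨hw, rfl⟩
  · intro h
    rcases Relation.ReflTransGen.cases_head h with h | ⟨c, hc, h⟩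
    · exact absurd h hx
    · exact hc.2 ▸ h

/-- An edge other than the tree edge of `x` leaves the subtree of `x` only if it is a
back-edge in `B x`. -/
theorem anc_fst_iff_anc_snd {x : Fin G.n} {e : G.Edge} (he : e ≠ G.tEdge x)
    (hB : e ∉ G.B x) : G.Anc x (G.fst e) ↔ G.Anc x (G.snd e) := by
  by_cases ht : G.IsTreeEdge e
  · obtain ⟨w, hw, rfl⟩ := ht
    rw [G.tEdge_fst w hw, G.tEdge_snd w hw]
    exact (anc_parent_iff hw fun h => he (h ▸ rfl)).symm
  · have hs : G.Anc (G.snd e) (G.fst e) := G.back_anc e ht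
    refine ⟨fun h => ?_, fun h => h.trans hs⟩
    by_contra hn
    rcases h.total hs with h' | h'
    · exact hn h'
    · exact hB ⟨ht, h, h', fun heq => hn (heq ▸ Relation.ReflTransGen.refl)⟩

/-- In a `3`-edge-connected graph, comparable non-root vertices with equal sets `B`
coincide, since otherwise their tree edges would form a `2`-cut. -/
theorem eq_of_B_eq (h3 : G.EdgeConn 3) {x y : Fin G.n} (hx : x ≠ G.root)
    (hxy : G.Anc x y) (hB : G.B x = G.B y) : x = y := by
  by_contra hne
  have hcard : ({G.tEdge x, G.tEdge y} : Set G.Edge).ncard < 3 :=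
    (Set.ncard_insert_le _ _).trans_lt (by simp)
  refine h3 _ hcard fun hconn => ?_
  have key : ∀ e, e ∉ ({G.tEdge x, G.tEdge y} : Set G.Edge) →
      ((G.Anc x (G.fst e) ∧ ¬ G.Anc y (G.fst e)) ↔
        (G.Anc x (G.snd e) ∧ ¬ G.Anc y (G.snd e))) := by
    intro e he
    simp only [Set.mem_insert_iff, Set.mem_singleton_iff, not_or] at he
    by_cases hmem : e ∈ G.B x
    · have hy : e ∈ G.B y := hB ▸ hmem
      exact iff_of_false (fun h => h.2 hy.2.1)
        fun h => hmem.2.2.2 (hmem.2.2.1.antisymm h.1)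
    · rw [anc_fst_iff_anc_snd he.1 hmem, anc_fst_iff_anc_snd he.2 (hB ▸ hmem)]
  have hreach : ∀ z, Relation.ReflTransGen (G.AdjOff {G.tEdge x, G.tEdge y}) x z →
      G.Anc x z ∧ ¬ G.Anc y z := by
    intro z hz
    induction hz with
    | refl => exact ⟨Relation.ReflTransGen.refl, fun h => hne (hxy.antisymm h)⟩
    | tail _ h ih =>
      obtain ⟨e, he, ⟨rfl, rfl⟩ | ⟨rfl, rfl⟩⟩ := h
      · exact (key e he).1 ih
      · exact (key e he).2 ih
  exact hx (le_antisymm (hreach _ (hconn x G.root)).1.le (G.root_le x))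

theorem IsM.anc {v m : Fin G.n} (h : G.IsM v m) : G.Anc v m :=
  h.2 v fun _ ⟨_, he, hx⟩ => hx ▸ he.2.1

theorem IsMtilde.anc {v m : Fin G.n} (h : G.IsMtilde v m) : G.Anc v m := by
  obtain ⟨_, _, _, h⟩ := h
  exact h.2 v fun _ ⟨_, he, hx, _⟩ => hx ▸ he.2.1

theorem IsMlow1.anc {v m : Fin G.n} (h : G.IsMlow1 v m) : G.Anc v m := by
  obtain ⟨_, _, _, _, _, h⟩ := h
  exact h.2 v fun _ ⟨_, he, hx, _⟩ => hx ▸ he.2.1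

/-- If `u` lies on the tree path from `v` to `M v`, then `B v ⊆ B u`. -/
theorem IsM.B_subset {u v m : Fin G.n} (hm : G.IsM v m) (hvu : G.Anc v u)
    (hum : G.Anc u m) : G.B v ⊆ G.B u :=
  fun e he => ⟨he.1, hum.trans (hm.1 _ ⟨e, he, rfl⟩), he.2.2.trans_anc hvu⟩

end DFSGraph

/-- Lemma 3.5: Let `G` be `3`-edge-connected with DFS tree `T` rooted
at `r`. Let `u` be a descendant of a vertex `v ≠ r` such that `m = M(v)` satisfies
`m ∈ {M(u), M̃(u), M_low1(u)}`. Then `u ∈ U(v)` if and only if `v` is the maximum vertex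
in `M⁻¹(m)` less than `u` and `b_count(u) = b_count(v) + 1`. -/
theorem stmt9 (G : DFSGraph) (h3 : G.EdgeConn 3) (u v m : Fin G.n)
    (hv : v ≠ G.root) (hanc : G.Anc v u)
    (hm : G.IsM v m)
    (hmem : G.IsM u m ∨ G.IsMtilde u m ∨ G.IsMlow1 u m) :
    (∃ e, G.IsBack e ∧ e ∉ G.B v ∧ G.B u = insert e (G.B v)) ↔
      ((v < u ∧ ∀ v', v' < u → G.IsM v' m → v' ≤ v) ∧
       G.bcount u = G.bcount v + 1) := by
  have := G.edgeFintype
  have hfin : (G.B v).Finite := Set.toFinite _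
  constructor
  · rintro ⟨e, -, he, heq⟩
    have hsub : G.B v ⊆ G.B u := heq ▸ Set.subset_insert e _
    have hne : v ≠ u := by
      rintro rfl
      exact he (heq ▸ Set.mem_insert e _)
    have hum : G.Anc u m := hm.2 u fun _ ⟨_, hf, hx⟩ => hx ▸ (hsub hf).2.1
    refine ⟨⟨lt_of_le_of_ne hanc.le hne, fun v' hv'u hv' => ?_⟩, ?_⟩
    · by_contra! hlt
      have hv'_anc : G.Anc v' u := hv'.anc.of_le hum hv'u.le
      have hvv' : G.Anc v v' := hm.anc.of_le hv'.anc hlt.le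
      have hv'_root : v' ≠ G.root := ((G.root_le v).trans_lt hlt).ne'
      have h₁ : G.B v ⊆ G.B v' := hm.B_subset hvv' hv'.anc
      have h₂ : G.B v' ⊆ G.B u := hv'.B_subset hv'_anc hum
      by_cases hev : e ∈ G.B v'
      · exact hv'u.ne (DFSGraph.eq_of_B_eq h3 hv'_root hv'_anc
          (h₂.antisymm (heq ▸ Set.insert_subset hev h₁)))
      · refine hlt.ne (DFSGraph.eq_of_B_eq h3 hv hvv' (h₁.antisymm fun f hf => ?_))
        have hfu : f ∈ insert e (G.B v) := heq ▸ h₂ hf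
        exact hfu.resolve_left fun h => hev (h ▸ hf)
    · rw [DFSGraph.bcount, heq, Set.ncard_insert_of_notMem he hfin, DFSGraph.bcount]
  · rintro ⟨-, hcount⟩
    have hum : G.Anc u m := hmem.elim (·.anc) (·.elim (·.anc) (·.anc))
    obtain ⟨e, he, heq⟩ := (Set.exists_eq_insert_iff_ncard hfin).2
      ⟨hm.B_subset hanc hum, hcount.symm⟩
    exact ⟨e, ((heq ▸ Set.mem_insert e _ : e ∈ G.B u)).1, he, heq.symm⟩
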